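/- arXiv:2405.04032 — 2 statements merged into one kernel-verified Lean document; each statement's English description precedes it below -/
import Mathlib

section
/- Variance of the LDP-ICL logit under Warner perturbation: with the notation and hypotheses as above (binary true labels y ∈ {0,1}ⁿ, p = e^ε/(e^ε+1), P(b | y) = p if b = y and 1−p otherwise), let Z̄ := Σ_{b ∈ {0,1}ⁿ} (Π_{i=1}^n P(b_i | y_i)) · Z(b) denote the expected logit. Then Σ_{b ∈ {0,1}ⁿ} (Π_{i=1}^n P(b_i | y_i)) · (Z(b) − Z̄)² = η² · (e^ε/(e^ε+1)²) · Σ_{i=1}^n ⟨x_i, x_test⟩². -/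
open scoped RealInnerProductSpace BigOperators

section ProductWeights

variable {α R : Type*} [Fintype α] [CommRing R]

/-- A sum over `(n + 1)`-tuples splits into a sum over the head and a sum over the tail. -/
theorem sum_fin_succ_pi {n : ℕ} (F : (Fin (n + 1) → α) → R) :
    ∑ b : Fin (n + 1) → α, F b = ∑ a : α, ∑ b : Fin n → α, F (Fin.cons a b) := by
  rw [← (Fin.consEquiv fun _ : Fin (n + 1) => α).sum_comp F, Fintype.sum_prod_type]
  rfl

/-- A product of normalized weights is normalized. -/
theorem sum_prod_weights_eq_one {n : ℕ} (q : Fin n → α → R) (hq : ∀ i, ∑ a, q i a = 1) :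
    ∑ b : Fin n → α, ∏ i, q i (b i) = 1 := by
  induction n with
  | zero => simp
  | succ n ih =>
    simp only [sum_fin_succ_pi, Fin.prod_univ_succ, Fin.cons_zero, Fin.cons_succ,
      ← Finset.mul_sum]
    rw [ih (fun i => q i.succ) fun i => hq i.succ]
    simpa using hq 0

/-- Under product weights, a sum of centered coordinate functions is centered. -/
theorem sum_prod_weights_mul_sum_eq_zero {n : ℕ} (q g : Fin n → α → R)
    (hq : ∀ i, ∑ a, q i a = 1) (hg : ∀ i, ∑ a, q i a * g i a = 0) :
    ∑ b : Fin n → α, (∏ i, q i (b i)) * ∑ i, g i (b i) = 0 := by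
  induction n with
  | zero => simp
  | succ n ih =>
    have hone := sum_prod_weights_eq_one (fun i => q i.succ) fun i => hq i.succ
    have hzero := ih (fun i => q i.succ) (fun i => g i.succ) (fun i => hq i.succ)
      fun i => hg i.succ
    simp only [sum_fin_succ_pi, Fin.prod_univ_succ, Fin.sum_univ_succ, Fin.cons_zero,
      Fin.cons_succ]
    rw [← hg 0]
    refine Finset.sum_congr rfl fun a _ => ?_
    calc
      _ = q 0 a * g 0 a * ∑ b : Fin n → α, ∏ i : Fin n, q i.succ (b i)
          + q 0 a * ∑ b : Fin n → α,
            (∏ i : Fin n, q i.succ (b i)) * ∑ i : Fin n, g i.succ (b i) := by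
        simp only [Finset.mul_sum (Finset.univ : Finset (Fin n → α)),
          ← Finset.sum_add_distrib]
        exact Finset.sum_congr rfl fun b _ => by ring
      _ = q 0 a * g 0 a := by rw [hone, hzero]; ring

/-- Under product weights, the second moment of a sum of centered coordinate functions is the
sum of their second moments. -/
theorem sum_prod_weights_mul_sum_sq {n : ℕ} (q g : Fin n → α → R)
    (hq : ∀ i, ∑ a, q i a = 1) (hg : ∀ i, ∑ a, q i a * g i a = 0) :
    ∑ b : Fin n → α, (∏ i, q i (b i)) * (∑ i, g i (b i)) ^ 2
      = ∑ i, ∑ a, q i a * g i a ^ 2 := by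
  induction n with
  | zero => simp
  | succ n ih =>
    have hone := sum_prod_weights_eq_one (fun i => q i.succ) fun i => hq i.succ
    have hzero := sum_prod_weights_mul_sum_eq_zero (fun i => q i.succ) (fun i => g i.succ)
      (fun i => hq i.succ) fun i => hg i.succ
    have hsq := ih (fun i => q i.succ) (fun i => g i.succ) (fun i => hq i.succ)
      fun i => hg i.succ
    simp only [sum_fin_succ_pi, Fin.prod_univ_succ, Fin.sum_univ_succ, Fin.cons_zero,
      Fin.cons_succ]
    rw [← hsq]
    set V := ∑ b : Fin n → α,
      (∏ i : Fin n, q i.succ (b i)) * (∑ i : Fin n, g i.succ (b i)) ^ 2 with hV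
    have hinner : ∀ a : α, ∑ b : Fin n → α, q 0 a * (∏ i : Fin n, q i.succ (b i))
        * (g 0 a + ∑ i : Fin n, g i.succ (b i)) ^ 2 = q 0 a * g 0 a ^ 2 + q 0 a * V := by
      intro a
      calc
        _ = q 0 a * g 0 a ^ 2 * ∑ b : Fin n → α, ∏ i : Fin n, q i.succ (b i)
            + 2 * q 0 a * g 0 a * ∑ b : Fin n → α,
              (∏ i : Fin n, q i.succ (b i)) * ∑ i : Fin n, g i.succ (b i)
            + q 0 a * V := by
          simp only [hV, Finset.mul_sum (Finset.univ : Finset (Fin n → α)),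
            ← Finset.sum_add_distrib]
          exact Finset.sum_congr rfl fun b _ => by ring
        _ = q 0 a * g 0 a ^ 2 + q 0 a * V := by rw [hone, hzero]; ring
    simp only [hinner, Finset.sum_add_distrib, ← Finset.sum_mul, hq 0, one_mul]

end ProductWeights

/-- Variance of the LDP-ICL logit under Warner perturbation: with keeping
probability `p = e^ε/(e^ε+1)` and expected logit `Z̄`, the variance equals
`η² (e^ε/(e^ε+1)²) Σ_i ⟨x_i,x_test⟩²`. -/
theorem variance_logit_LDP_ICL
    (N n : ℕ) (σ : ℝ → ℝ) (hσ : σ = fun z => 1 / (1 + Real.exp (-z)))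
    (w₀ : EuclideanSpace ℝ (Fin N)) (x : Fin n → EuclideanSpace ℝ (Fin N))
    (η : ℝ) (xtest : EuclideanSpace ℝ (Fin N))
    (Z : (Fin n → ℝ) → ℝ)
    (hZ : Z = fun y => ⟪w₀, xtest⟫
      - η * ∑ i : Fin n, (σ ⟪w₀, x i⟫ - y i) * ⟪x i, xtest⟫)
    (y : Fin n → Bool) (ε : ℝ) (hε : 0 ≤ ε)
    (p : ℝ) (hp : p = Real.exp ε / (Real.exp ε + 1))
    (P : Bool → Bool → ℝ) (hP : P = fun b t => if b = t then p else 1 - p)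
    (Zbar : ℝ)
    (hZbar : Zbar = ∑ b : Fin n → Bool,
      (∏ i : Fin n, P (b i) (y i)) * Z (fun i => if b i then 1 else 0)) :
    ∑ b : Fin n → Bool,
        (∏ i : Fin n, P (b i) (y i))
          * (Z (fun i => if b i then 1 else 0) - Zbar) ^ 2
      = η ^ 2 * (Real.exp ε / (Real.exp ε + 1) ^ 2)
          * ∑ i : Fin n, ⟪x i, xtest⟫ ^ 2 := by
  have hq : ∀ i, ∑ a, P a (y i) = 1 := by
    intro i
    cases hy : y i <;> simp [hP]
  set g : Fin n → Bool → ℝ := fun i a =>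
    η * ⟪x i, xtest⟫ * ((if a then 1 else 0) - P true (y i)) with hgdef
  have hg : ∀ i, ∑ a, P a (y i) * g i a = 0 := by
    intro i
    cases hy : y i <;> simp [hP, hgdef, hy] <;> ring
  obtain ⟨c, hc⟩ : ∃ c : ℝ, ∀ b : Fin n → Bool,
      Z (fun i => if b i then 1 else 0) = c + ∑ i, g i (b i) := by
    refine ⟨⟪w₀, xtest⟫ - η * ∑ i, (σ ⟪w₀, x i⟫ - P true (y i)) * ⟪x i, xtest⟫, fun b => ?_⟩
    rw [hZ]
    simp only [hgdef, Finset.mul_sum]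
    rw [sub_add, ← Finset.sum_sub_distrib]
    exact congrArg _ (Finset.sum_congr rfl fun i _ => by ring)
  have hmean : Zbar = c := by
    rw [hZbar]
    simp only [hc, mul_add, Finset.sum_add_distrib, ← Finset.sum_mul]
    rw [sum_prod_weights_eq_one (fun i a => P a (y i)) hq,
      sum_prod_weights_mul_sum_eq_zero (fun i a => P a (y i)) g hq hg]
    ring
  simp only [hc, hmean, add_sub_cancel_left]
  rw [sum_prod_weights_mul_sum_sq (fun i a => P a (y i)) g hq hg, Finset.mul_sum]
  refine Finset.sum_congr rfl fun i _ => ?_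
  have hvar : Real.exp ε / (Real.exp ε + 1) ^ 2 = p * (1 - p) := by
    have : Real.exp ε + 1 ≠ 0 := by positivity
    rw [hp]
    field_simp
    ring
  rw [hvar]
  cases hy : y i <;> simp [hP, hgdef, hy] <;> ring
end

section
/- Privacy–utility trade-off for the expected logit: fix w₀ ∈ ℝ^N, x₁, …, x_n ∈ ℝ^N, x_test ∈ ℝ^N and η ≥ 0, and suppose all true labels equal 1 and ⟨x_i, x_test⟩ ≥ 0 for every i. For ε ≥ 0 set p(ε) = e^ε/(e^ε+1) and define the expected LDP-ICL logit E(ε) := ⟨w₀, x_test⟩ − η · Σ_{i=1}^n ( σ(⟨w₀, x_i⟩) − p(ε) ) · ⟨x_i, x_test⟩. Then E is monotone nondecreasing in ε: for all 0 ≤ ε₁ ≤ ε₂, E(ε₁) ≤ E(ε₂); i.e., stronger privacy (smaller ε) yields a smaller expected logit for the true label. -/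
open scoped RealInnerProductSpace BigOperators

/-- Privacy–utility trade-off: with all true labels equal to `1`, `η ≥ 0` and
`⟨x_i, x_test⟩ ≥ 0` for all `i`, the expected LDP-ICL logit
`E(ε) = ⟨w₀,x_test⟩ - η Σ_i (σ(⟨w₀,x_i⟩) - p(ε)) ⟨x_i,x_test⟩` with
`p(ε) = e^ε/(e^ε+1)` is monotone nondecreasing in the privacy budget `ε`. -/
theorem expected_logit_monotone_in_epsilon
    (N n : ℕ) (σ : ℝ → ℝ) (hσ : σ = fun z => 1 / (1 + Real.exp (-z)))
    (w₀ : EuclideanSpace ℝ (Fin N)) (x : Fin n → EuclideanSpace ℝ (Fin N))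
    (η : ℝ) (xtest : EuclideanSpace ℝ (Fin N))
    (hη : 0 ≤ η) (hx : ∀ i : Fin n, 0 ≤ ⟪x i, xtest⟫)
    (p : ℝ → ℝ) (hp : p = fun ε => Real.exp ε / (Real.exp ε + 1))
    (E : ℝ → ℝ)
    (hE : E = fun ε => ⟪w₀, xtest⟫
      - η * ∑ i : Fin n, (σ ⟪w₀, x i⟫ - p ε) * ⟪x i, xtest⟫) :
    ∀ ε₁ ε₂ : ℝ, 0 ≤ ε₁ → ε₁ ≤ ε₂ → E ε₁ ≤ E ε₂ := by
  intro ε₁ ε₂ _ h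
  have hmono : p ε₁ ≤ p ε₂ := by
    have hexp := Real.exp_le_exp.mpr h
    simp only [hp]
    rw [div_le_div_iff₀ (by positivity) (by positivity)]
    linarith
  simp only [hE]
  refine sub_le_sub_left (mul_le_mul_of_nonneg_left (Finset.sum_le_sum fun i _ => ?_) hη) _
  exact mul_le_mul_of_nonneg_right (sub_le_sub_left hmono _) (hx i)
end
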